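/- Let k ≥ 1 be a natural number, let μ₁, μ₂ : Fin k → ℝ, and let Σ₁, Σ₂ be k×k real positive definite matrices. For j = 1,2 define the multivariate normal density f_j : (Fin k → ℝ) → ℝ by f_j(x) = ((2π)^k · det Σ_j)^(−1/2) · exp(−(1/2) · (x−μ_j)ᵀ Σ_j⁻¹ (x−μ_j)). Let Σ = (Σ₁ + Σ₂)/2. Then the Bhattacharyya distance between the two densities satisfies −ln ( ∫_{ℝ^k} √(f₁(x) · f₂(x)) dx ) = (1/8) · (μ₁−μ₂)ᵀ Σ⁻¹ (μ₁−μ₂) + (1/2) · ln ( det Σ / √(det Σ₁ · det Σ₂) ). -/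

import Mathlib

open Real MeasureTheory Matrix

open scoped MatrixOrder Matrix.Norms.L2Operator in
/-- A real positive definite matrix factors as `Nᵀ * N`. -/
theorem Matrix.PosDef.exists_eq_transpose_mul_self {n : Type*} [Fintype n] [DecidableEq n]
    {M : Matrix n n ℝ} (hM : M.PosDef) : ∃ N : Matrix n n ℝ, M = Nᵀ * N := by
  obtain ⟨N, hN⟩ := CStarAlgebra.nonneg_iff_eq_star_mul_self.mp hM.posSemidef.nonneg
  exact ⟨N, by simpa [star_eq_conjTranspose] using hN⟩

theorem integral_exp_neg_dotProduct_self {n : Type*} [Fintype n] :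
    ∫ x : n → ℝ, Real.exp (-(x ⬝ᵥ x)) = √π ^ Fintype.card n := by
  have h (x : n → ℝ) : Real.exp (-(x ⬝ᵥ x)) = ∏ i, Real.exp (-1 * x i ^ 2) := by
    simp [← Real.exp_sum, dotProduct, Finset.sum_neg_distrib, sq]
  simp_rw [h]
  rw [integral_fintype_prod_volume_eq_pow (fun t : ℝ => Real.exp (-1 * t ^ 2)),
    integral_gaussian, div_one]

/-- The centred Gaussian integral of a positive definite quadratic form. -/
theorem Matrix.PosDef.integral_exp_neg_dotProduct_mulVec {n : Type*} [Fintype n] [DecidableEq n]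
    {M : Matrix n n ℝ} (hM : M.PosDef) :
    ∫ x : n → ℝ, Real.exp (-(x ⬝ᵥ (M *ᵥ x))) = √π ^ Fintype.card n / √M.det := by
  obtain ⟨N, rfl⟩ := hM.exists_eq_transpose_mul_self
  have hdet : N.det ≠ 0 := by
    intro h
    simpa [h] using hM.det_pos
  have hmap := Real.map_matrix_volume_pi_eq_smul_volume_pi hdet
  have hint : ∫ x : n → ℝ, Real.exp (-(x ⬝ᵥ x)) ∂(Measure.map (toLin' N) volume)
      = ∫ x : n → ℝ, Real.exp (-((N *ᵥ x) ⬝ᵥ (N *ᵥ x))) := by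
    rw [integral_map]
    · simp
    · exact (LinearMap.continuous_of_finiteDimensional _).aemeasurable
    · exact (by unfold dotProduct; fun_prop :
        Continuous fun x : n → ℝ => Real.exp (-(x ⬝ᵥ x))).aestronglyMeasurable
  have hquad (x : n → ℝ) : x ⬝ᵥ ((Nᵀ * N) *ᵥ x) = (N *ᵥ x) ⬝ᵥ (N *ᵥ x) := by
    rw [← mulVec_mulVec, dotProduct_mulVec, vecMul_transpose]
  simp_rw [hquad]
  rw [← hint, hmap, integral_smul_measure, integral_exp_neg_dotProduct_self,
    ENNReal.toReal_ofReal (abs_nonneg _), det_mul, det_transpose, Real.sqrt_mul_self_eq_abs,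
    abs_inv, smul_eq_mul]
  ring

/-- Completing the square in a sum of two quadratic forms: the minimizer of the sum is
`μ₁ - S₁ (S₁ + S₂)⁻¹ (μ₁ - μ₂) = μ₂ + S₂ (S₁ + S₂)⁻¹ (μ₁ - μ₂)`. -/
theorem Matrix.PosDef.dotProduct_inv_mulVec_add {n : Type*} [Fintype n] [DecidableEq n]
    {S₁ S₂ : Matrix n n ℝ} (hS₁ : S₁.PosDef) (hS₂ : S₂.PosDef) (μ₁ μ₂ y : n → ℝ) :
    let x := y + (μ₁ - S₁ *ᵥ ((S₁ + S₂)⁻¹ *ᵥ (μ₁ - μ₂)))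
    (x - μ₁) ⬝ᵥ (S₁⁻¹ *ᵥ (x - μ₁)) + (x - μ₂) ⬝ᵥ (S₂⁻¹ *ᵥ (x - μ₂)) =
      y ⬝ᵥ ((S₁⁻¹ + S₂⁻¹) *ᵥ y) + (μ₁ - μ₂) ⬝ᵥ ((S₁ + S₂)⁻¹ *ᵥ (μ₁ - μ₂)) := by
  intro x
  set u := (S₁ + S₂)⁻¹ *ᵥ (μ₁ - μ₂) with hu
  have hadd : S₁ *ᵥ u + S₂ *ᵥ u = μ₁ - μ₂ := by
    rw [← add_mulVec, hu, mulVec_mulVec,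
      mul_nonsing_inv _ ((hS₁.add hS₂).isUnit.map detMonoidHom), one_mulVec]
  have hx₁ : x - μ₁ = y - S₁ *ᵥ u := by simp only [x]; abel
  have hx₂ : x - μ₂ = y + S₂ *ᵥ u := by
    have h : x - μ₂ = y - S₁ *ᵥ u + (μ₁ - μ₂) := by simp only [x]; abel
    rw [h, ← hadd]; abel
  have hinv {S : Matrix n n ℝ} (hS : S.PosDef) (v : n → ℝ) : S⁻¹ *ᵥ (S *ᵥ v) = v := by
    rw [mulVec_mulVec, nonsing_inv_mul _ (hS.isUnit.map detMonoidHom), one_mulVec]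
  have hsymm {S : Matrix n n ℝ} (hS : S.PosDef) (v w : n → ℝ) :
      (S *ᵥ v) ⬝ᵥ (S⁻¹ *ᵥ w) = v ⬝ᵥ w := by
    have ht : Sᵀ = S := by simpa [IsHermitian] using hS.isHermitian
    rw [← vecMul_transpose, ht, ← dotProduct_mulVec, mulVec_mulVec,
      mul_nonsing_inv _ (hS.isUnit.map detMonoidHom), one_mulVec]
  rw [hx₁, hx₂, ← hadd]
  simp only [mulVec_sub, mulVec_add, add_mulVec, hinv hS₁, hinv hS₂, sub_dotProduct,
    add_dotProduct, dotProduct_sub, dotProduct_add, hsymm hS₁, hsymm hS₂,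
    dotProduct_comm u y]
  ring

theorem Matrix.PosDef.det_inv_add_inv {n : Type*} [Fintype n] [DecidableEq n]
    {S₁ S₂ : Matrix n n ℝ} (hS₁ : S₁.PosDef) (hS₂ : S₂.PosDef) :
    (S₁⁻¹ + S₂⁻¹).det = (S₁ + S₂).det / (S₁.det * S₂.det) := by
  have h : S₁⁻¹ + S₂⁻¹ = S₁⁻¹ * (S₁ + S₂) * S₂⁻¹ := by
    rw [mul_add, add_mul, nonsing_inv_mul _ (hS₁.isUnit.map detMonoidHom), one_mul,
      mul_assoc, mul_nonsing_inv _ (hS₂.isUnit.map detMonoidHom), mul_one, add_comm]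
  rw [h, det_mul, det_mul, det_nonsing_inv, det_nonsing_inv, Ring.inverse_eq_inv']
  field_simp

theorem Matrix.div_two_eq_smul {n : Type*} [Fintype n] [DecidableEq n] (S : Matrix n n ℝ) :
    S / 2 = (1 / 2 : ℝ) • S := by
  have h : (2 : Matrix n n ℝ)⁻¹ = (1 / 2 : ℝ) • 1 := by
    apply inv_eq_left_inv
    rw [smul_mul_assoc, one_mul, show (2 : Matrix n n ℝ) = (2 : ℝ) • 1 by
      rw [two_smul, one_add_one_eq_two], smul_smul]
    norm_num
  rw [div_eq_mul_inv, h, mul_smul_comm, mul_one]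

/-- Bhattacharyya distance between two multivariate normal densities:
`D_B = (1/8)(μ₁−μ₂)ᵀ Σ⁻¹ (μ₁−μ₂) + (1/2) ln(det Σ / √(det Σ₁ det Σ₂))` with
`Σ = (Σ₁+Σ₂)/2`. -/
theorem bhattacharyya_multivariate_normal
    (k : ℕ) (hk : 1 ≤ k) (μ₁ μ₂ : Fin k → ℝ)
    (S₁ S₂ : Matrix (Fin k) (Fin k) ℝ) (hS₁ : S₁.PosDef) (hS₂ : S₂.PosDef)
    (f₁ f₂ : (Fin k → ℝ) → ℝ)
    (hf₁ : ∀ x, f₁ x = ((2 * π) ^ k * S₁.det) ^ (-(1/2) : ℝ) *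
        Real.exp (-(1/2) * ((x - μ₁) ⬝ᵥ (S₁⁻¹ *ᵥ (x - μ₁)))))
    (hf₂ : ∀ x, f₂ x = ((2 * π) ^ k * S₂.det) ^ (-(1/2) : ℝ) *
        Real.exp (-(1/2) * ((x - μ₂) ⬝ᵥ (S₂⁻¹ *ᵥ (x - μ₂))))) :
    -Real.log (∫ x : Fin k → ℝ, Real.sqrt (f₁ x * f₂ x)) =
      (1/8) * ((μ₁ - μ₂) ⬝ᵥ (((S₁ + S₂) / 2)⁻¹ *ᵥ (μ₁ - μ₂))) +
      (1/2) * Real.log (((S₁ + S₂) / 2).det / Real.sqrt (S₁.det * S₂.det)) := by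
  have hd₁ := hS₁.det_pos
  have hd₂ := hS₂.det_pos
  have hd := (hS₁.add hS₂).det_pos
  have hM : ((1 / 4 : ℝ) • (S₁⁻¹ + S₂⁻¹)).PosDef := (hS₁.inv.add hS₂.inv).smul (by norm_num)
  set c₁ := ((2 * π) ^ k * S₁.det) ^ (-(1/2) : ℝ) with hc₁
  set c₂ := ((2 * π) ^ k * S₂.det) ^ (-(1/2) : ℝ) with hc₂
  have hc₁pos : 0 < c₁ := by positivity
  have hc₂pos : 0 < c₂ := by positivity
  set q := (μ₁ - μ₂) ⬝ᵥ ((S₁ + S₂)⁻¹ *ᵥ (μ₁ - μ₂)) with hq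
  set m := μ₁ - S₁ *ᵥ ((S₁ + S₂)⁻¹ *ᵥ (μ₁ - μ₂)) with hm
  have hintegrand (y : Fin k → ℝ) : √(f₁ (y + m) * f₂ (y + m)) =
      √(c₁ * c₂) * Real.exp (-(q / 4)) *
        Real.exp (-(y ⬝ᵥ (((1 / 4 : ℝ) • (S₁⁻¹ + S₂⁻¹)) *ᵥ y))) := by
    have hsq := hS₁.dotProduct_inv_mulVec_add hS₂ μ₁ μ₂ y
    rw [hf₁, hf₂, mul_mul_mul_comm, Real.sqrt_mul (by positivity), ← Real.exp_add,
      ← Real.exp_half, mul_assoc, ← Real.exp_add, smul_mulVec, dotProduct_smul, smul_eq_mul]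
    congr 2
    linear_combination (-1 / 4) * hsq
  have hintegral : ∫ x : Fin k → ℝ, √(f₁ x * f₂ x) =
      √(c₁ * c₂) * Real.exp (-(q / 4)) *
        (√π ^ k / √((1 / 4 : ℝ) ^ k * ((S₁ + S₂).det / (S₁.det * S₂.det)))) := by
    rw [← integral_add_right_eq_self _ m]
    simp_rw [hintegrand]
    rw [integral_const_mul, hM.integral_exp_neg_dotProduct_mulVec, det_smul,
      hS₁.det_inv_add_inv hS₂, Fintype.card_fin]
  have hSinv : ((1 / 2 : ℝ) • (S₁ + S₂))⁻¹ = (2 : ℝ) • (S₁ + S₂)⁻¹ := by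
    apply inv_eq_left_inv
    rw [smul_mul_smul_comm, nonsing_inv_mul _ ((hS₁.add hS₂).isUnit.map detMonoidHom)]
    norm_num
  have hlog₄ : Real.log (1 / 4) = -(2 * Real.log 2) := by
    rw [one_div, Real.log_inv, show (4 : ℝ) = 2 ^ 2 by norm_num, Real.log_pow]
    norm_num
  have hlogc {d : ℝ} (hd : 0 < d) : Real.log (((2 * π) ^ k * d) ^ (-(1/2) : ℝ)) =
      -(1 / 2) * (k * (Real.log 2 + Real.log π) + Real.log d) := by
    rw [Real.log_rpow (by positivity), Real.log_mul (by positivity) hd.ne', Real.log_pow,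
      Real.log_mul two_ne_zero pi_ne_zero]
  rw [hintegral, div_two_eq_smul, hSinv, smul_mulVec, dotProduct_smul, ← hq, det_smul,
    Fintype.card_fin, smul_eq_mul]
  rw [Real.log_mul (by positivity) (by positivity), Real.log_mul (by positivity) (by positivity),
    Real.log_exp, Real.log_sqrt (by positivity), Real.log_mul hc₁pos.ne' hc₂pos.ne',
    hc₁, hc₂, hlogc hd₁, hlogc hd₂, Real.log_div (by positivity) (by positivity), Real.log_pow,
    Real.log_sqrt pi_pos.le, Real.log_sqrt (by positivity),
    Real.log_mul (by positivity) (by positivity), Real.log_pow, hlog₄,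
    Real.log_div (by positivity) (by positivity), Real.log_mul hd₁.ne' hd₂.ne',
    Real.log_div (by positivity) (by positivity), Real.log_sqrt (by positivity),
    Real.log_mul (by positivity) hd.ne', Real.log_pow, Real.log_mul hd₁.ne' hd₂.ne',
    one_div 2, Real.log_inv]
  ring
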